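/- Let a ∈ ℝ^{n₂} be a nonzero vector with a₁ ≥ a₂ ≥ ⋯ ≥ a_{n₂} ≥ 0, let 1 ≤ k < n₂, ρ > 0, and set w = (a₁,…,a_k), c = √(a_{k+1}² + ⋯ + a_{n₂}²), and ℓ = ‖w‖₀. Let d_ρ(w,c) ∈ ℝ^k be defined by: d_ρ(w,c) = 0 if ρ ≥ ‖w‖∞/√(‖w‖₂² + c²); d_ρ(w,c) = w − ρ√(c²/(1 − kρ²))·1_k if 0 < ρ ≤ w_ℓ/√(ℓw_ℓ² + c²); and d_ρ(w,c) = max(w − t_i·1_k, 0) otherwise, where i ∈ {1,…,ℓ−1} is the unique integer satisfying w_{i+1} ≤ t_i < w_i with t_i := √((w_{i+1}² + ⋯ + w_k² + c²)/(1/ρ² − i)). Then the padded vector [d_ρ(w,c); 0_{n₂−k}] ∈ ℝ^{n₂} is an optimal solution of the problem: minimize ‖s − a‖₂ + ρ‖s‖₁ over s ∈ ℝ^{n₂} with s ≥ 0 entrywise, if and only if ρ ≥ a_{ℓ+1}/√(ℓ·a_{ℓ+1}² + c²). -/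

import Mathlib

/-- The sup norm `‖v‖∞ = maxᵢ |vᵢ|`. -/
noncomputable def normInf {n : ℕ} (v : Fin n → ℝ) : ℝ :=
  ⨆ i, |v i|

/-- `‖v‖₀`: the number of nonzero entries of `v`. -/
noncomputable def norm0 {n : ℕ} (v : Fin n → ℝ) : ℕ :=
  (Finset.univ.filter fun i => v i ≠ 0).card

/-- The vector `w` extended to `ℕ` by zero; `wext w j` is the (1-based) `(j+1)`-th entry. -/
noncomputable def wext {n : ℕ} (w : Fin n → ℝ) (j : ℕ) : ℝ :=
  if h : j < n then w ⟨j, h⟩ else 0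

/-- Tail sum of squares `w_{i+1}² + ⋯ + w_k²` (1-based indexing). -/
noncomputable def tailSq {n : ℕ} (w : Fin n → ℝ) (i : ℕ) : ℝ :=
  ∑ j : Fin n, if i ≤ (j : ℕ) then (w j) ^ 2 else 0

/-- `t_i = √((w_{i+1}² + ⋯ + w_k² + c²)/(1/ρ² − i))`. -/
noncomputable def tQ {n : ℕ} (ρ c : ℝ) (w : Fin n → ℝ) (i : ℕ) : ℝ :=
  Real.sqrt ((tailSq w i + c ^ 2) / (1 / ρ ^ 2 - i))

/-- `d = d_ρ(w,c)`: the piecewise definition of Theorem `d_ρ(w,c)` for a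
nonnegative nonzero vector `w` sorted in descending order and `c ≥ 0`. -/
def dSpecC {k : ℕ} (ρ c : ℝ) (w d : Fin k → ℝ) : Prop :=
  (normInf w / Real.sqrt ((∑ i, w i ^ 2) + c ^ 2) ≤ ρ ∧ d = 0) ∨
  (ρ ≤ wext w (norm0 w - 1) /
      Real.sqrt ((norm0 w : ℝ) * wext w (norm0 w - 1) ^ 2 + c ^ 2) ∧
    d = fun j => w j - ρ * Real.sqrt (c ^ 2 / (1 - (k : ℝ) * ρ ^ 2))) ∨
  (wext w (norm0 w - 1) /
      Real.sqrt ((norm0 w : ℝ) * wext w (norm0 w - 1) ^ 2 + c ^ 2) < ρ ∧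
    ρ < normInf w / Real.sqrt ((∑ i, w i ^ 2) + c ^ 2) ∧
    ∃ i : ℕ, (1 ≤ i ∧ i ≤ norm0 w - 1) ∧
      wext w i ≤ tQ ρ c w i ∧ tQ ρ c w i < wext w (i - 1) ∧
      d = fun j => max (w j - tQ ρ c w i) 0)

/-- `s` is an optimal solution of: minimize `‖s − a‖₂ + ρ‖s‖₁` over `s ≥ 0`. -/
def IsOptNN {n : ℕ} (a : Fin n → ℝ) (ρ : ℝ) (s : Fin n → ℝ) : Prop :=
  (∀ i, 0 ≤ s i) ∧
  ∀ s' : Fin n → ℝ, (∀ i, 0 ≤ s' i) →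
    Real.sqrt (∑ i, (s i - a i) ^ 2) + ρ * ∑ i, |s i| ≤
      Real.sqrt (∑ i, (s' i - a i) ^ 2) + ρ * ∑ i, |s' i|

theorem sum_fin_eq_sum_castLE_add_tail {n k : ℕ} (hk : k ≤ n) (g : Fin n → ℝ) :
    ∑ i, g i = ∑ j : Fin k, g (Fin.castLE hk j) +
      ∑ i : Fin n, if k ≤ (i : ℕ) then g i else 0 := by
  obtain ⟨m, rfl⟩ := Nat.exists_eq_add_of_le hk
  have hlt : ∀ j : Fin k, ¬ k ≤ (j : ℕ) := fun j => by omega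
  rw [Fin.sum_univ_add, Fin.sum_univ_add (fun i : Fin (k + m) => if k ≤ (i : ℕ) then g i else 0)]
  simp [hlt]
  rfl

theorem ne_zero_iff_lt_norm0 {k : ℕ} {w : Fin k → ℝ} (hw : Antitone w) (hnn : ∀ i, 0 ≤ w i)
    (j : Fin k) : w j ≠ 0 ↔ (j : ℕ) < norm0 w := by
  constructor
  · intro hj
    have hsub : Finset.Iic j ⊆ Finset.univ.filter fun i => w i ≠ 0 := by
      intro i hi
      have hpos := lt_of_le_of_ne (hnn j) hj.symm
      exact Finset.mem_filter.mpr
        ⟨Finset.mem_univ _, (hpos.trans_le (hw (Finset.mem_Iic.mp hi))).ne'⟩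
    have := Finset.card_le_card hsub
    rw [Fin.card_Iic] at this
    exact this
  · intro hj h0
    have hsub : (Finset.univ.filter fun i => w i ≠ 0) ⊆ Finset.Iio j := by
      intro i hi
      rw [Finset.mem_Iio]
      by_contra hij
      exact (Finset.mem_filter.mp hi).2
        (le_antisymm (h0 ▸ hw (not_lt.mp hij)) (hnn i))
    have := Finset.card_le_card hsub
    rw [Fin.card_Iio] at this
    exact absurd hj (not_lt.mpr this)

theorem norm0_le {k : ℕ} (w : Fin k → ℝ) : norm0 w ≤ k := by
  simpa [norm0] using Finset.card_filter_le Finset.univ (fun i => w i ≠ 0)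

theorem div_sqrt_le_iff_sq_le {x D ρ : ℝ} (hx : 0 ≤ x) (hρ : 0 < ρ) (hD : x ^ 2 ≤ D) :
    x / Real.sqrt D ≤ ρ ↔ x ^ 2 ≤ ρ ^ 2 * D := by
  rcases (le_trans (sq_nonneg x) hD).eq_or_lt with h | h
  · have hx0 : x = 0 := by nlinarith
    simp [← h, hx0, hρ.le]
  · rw [div_le_iff₀ (Real.sqrt_pos.mpr h), ← abs_of_nonneg hx,
      ← abs_of_nonneg (mul_nonneg hρ.le (Real.sqrt_nonneg D)), ← sq_le_sq, mul_pow,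
      Real.sq_sqrt h.le, sq_abs]

theorem mul_le_sq_of_le_div_sqrt {x D ρ : ℝ} (hρ : 0 < ρ) (hD : 0 ≤ D)
    (h : ρ ≤ x / Real.sqrt D) : ρ ^ 2 * D ≤ x ^ 2 := by
  rcases hD.eq_or_lt with h0 | h0
  · simp [← h0, sq_nonneg]
  · rw [le_div_iff₀ (Real.sqrt_pos.mpr h0)] at h
    have := pow_le_pow_left₀ (by positivity) h 2
    rwa [mul_pow, Real.sq_sqrt h0.le] at this

theorem sq_le_mul_of_le {x u ρ m e : ℝ} (hx : 0 ≤ x) (hxu : x ≤ u) (he : 0 ≤ e)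
    (h : u ^ 2 ≤ ρ ^ 2 * (m * u ^ 2 + e)) : x ^ 2 ≤ ρ ^ 2 * (m * x ^ 2 + e) := by
  have hsq : x ^ 2 ≤ u ^ 2 := pow_le_pow_left₀ hx hxu 2
  have hρe : 0 ≤ ρ ^ 2 * e := by positivity
  rcases le_total (1 - ρ ^ 2 * m) 0 with h1 | h1
  · nlinarith [mul_nonneg (sq_nonneg x) (neg_nonneg.mpr h1)]
  · nlinarith [mul_le_mul_of_nonneg_right hsq h1]

/-- The KKT conditions are sufficient for optimality when the residual is nonzero. -/
theorem isOptNN_of_kkt {n : ℕ} {a s : Fin n → ℝ} {ρ R : ℝ} (hs : ∀ i, 0 ≤ s i) (hR : 0 < R)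
    (hres : ∑ i, (s i - a i) ^ 2 = R ^ 2) (hdual : ∀ i, a i - s i ≤ ρ * R)
    (hcompl : ∀ i, s i * (ρ * R - (a i - s i)) = 0) : IsOptNN a ρ s := by
  refine ⟨hs, fun s' hs' => ?_⟩
  rw [hres, Real.sqrt_sq hR.le, Finset.sum_congr rfl fun i _ => abs_of_nonneg (hs i),
    Finset.sum_congr rfl fun i _ => abs_of_nonneg (hs' i)]
  have hcs := Real.sum_mul_le_sqrt_mul_sqrt Finset.univ (fun i => s i - a i)
    (fun i => s' i - a i)
  rw [hres, Real.sqrt_sq hR.le] at hcs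
  have hgrad : 0 ≤ ∑ i, (s' i - s i) * (ρ * R - (a i - s i)) :=
    Finset.sum_nonneg fun i _ => by
      nlinarith [hcompl i, mul_nonneg (hs' i) (sub_nonneg.mpr (hdual i))]
  have hexp : ∑ i, (s' i - s i) * (ρ * R - (a i - s i)) =
      ρ * R * (∑ i, s' i - ∑ i, s i) + ∑ i, (s i - a i) * (s' i - a i) - R ^ 2 := by
    rw [← hres, ← Finset.sum_sub_distrib, Finset.mul_sum, ← Finset.sum_add_distrib,
      ← Finset.sum_sub_distrib]
    exact Finset.sum_congr rfl fun i _ => by ring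
  refine le_of_mul_le_mul_left ?_ hR
  nlinarith

/-- First-order optimality in a coordinate where the optimal solution vanishes. -/
theorem IsOptNN.le_mul_residual {n : ℕ} {a s : Fin n → ℝ} {ρ R : ℝ} (h : IsOptNN a ρ s)
    (hρ : 0 < ρ) (hR : 0 ≤ R) (hres : ∑ i, (s i - a i) ^ 2 = R ^ 2) {j : Fin n}
    (hj : s j = 0) : a j ≤ ρ * R := by
  by_contra! hlt
  obtain ⟨ε, hε⟩ : ∃ ε, ε = (a j - ρ * R) / 2 := ⟨_, rfl⟩
  have hε0 : 0 < ε := by linarith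
  have hs' : ∀ i, 0 ≤ Function.update s j ε i := by
    intro i
    rcases eq_or_ne i j with rfl | hij
    · simpa using hε0.le
    · simpa [hij] using h.1 i
  have hopt := h.2 _ hs'
  rw [hres, Real.sqrt_sq hR, Finset.sum_congr rfl fun i _ => abs_of_nonneg (h.1 i),
    Finset.sum_congr rfl fun i _ => abs_of_nonneg (hs' i)] at hopt
  have hsum : ∀ g : Fin n → ℝ → ℝ, ∑ i, g i (Function.update s j ε i) =
      ∑ i, g i (s i) + (g j ε - g j (s j)) := by
    intro g
    rw [← Finset.add_sum_erase _ _ (Finset.mem_univ j),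
      ← Finset.add_sum_erase _ (fun i => g i (s i)) (Finset.mem_univ j)]
    have : ∑ i ∈ Finset.univ.erase j, g i (Function.update s j ε i) =
        ∑ i ∈ Finset.univ.erase j, g i (s i) :=
      Finset.sum_congr rfl fun i hi => by
        rw [Function.update_of_ne (Finset.ne_of_mem_erase hi)]
    rw [this, Function.update_self]
    ring
  have h1 := hsum fun _ x => x
  have h2 := hsum fun i x => (x - a i) ^ 2
  rw [hres, hj] at h2
  rw [h1, hj] at hopt
  have hnonneg : 0 ≤ ∑ i, (Function.update s j ε i - a i) ^ 2 :=
    Finset.sum_nonneg fun i _ => sq_nonneg _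
  have hsq := Real.sq_sqrt hnonneg
  obtain ⟨R', hR'⟩ : ∃ R', R' = Real.sqrt (∑ i, (Function.update s j ε i - a i) ^ 2) := ⟨_, rfl⟩
  have hR'0 : 0 ≤ R' := hR' ▸ Real.sqrt_nonneg _
  rw [← hR'] at hsq hopt
  rw [h2] at hsq
  have hρR : 0 ≤ ρ * R := by positivity
  have hle : R' ≤ R := abs_le_of_sq_le_sq' (by nlinarith) hR |>.2
  have hdiff : R - R' ≤ ρ * ε := by linarith
  have hbound : (R - R') * (R + R') ≤ ρ * ε * (2 * R) :=
    mul_le_mul hdiff (by linarith) (by linarith) (by positivity)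
  have : ε * (2 * a j - ε) ≤ ε * (2 * (ρ * R)) := by nlinarith
  have := le_of_mul_le_mul_left this hε0
  linarith

/-- The vector itself is optimal when its support has at most `1 / ρ ^ 2` elements. -/
theorem isOptNN_self {n : ℕ} {a : Fin n → ℝ} {ρ : ℝ} (ha : ∀ i, 0 ≤ a i) (hρ : 0 < ρ)
    (S : Finset (Fin n)) (hS : ∀ i ∉ S, a i = 0) (hcard : ρ ^ 2 * (S.card : ℝ) ≤ 1) :
    IsOptNN a ρ a := by
  refine ⟨ha, fun s' hs' => ?_⟩
  rw [Finset.sum_congr rfl fun i _ => abs_of_nonneg (ha i),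
    Finset.sum_congr rfl fun i _ => abs_of_nonneg (hs' i)]
  simp only [sub_self, ne_eq, OfNat.ofNat_ne_zero, not_false_eq_true, zero_pow,
    Finset.sum_const_zero, Real.sqrt_zero, zero_add]
  have hcs := sq_sum_le_card_mul_sum_sq (s := S) (f := fun i => s' i - a i)
  have hsub : ∑ i ∈ S, (s' i - a i) ^ 2 ≤ ∑ i, (s' i - a i) ^ 2 :=
    Finset.sum_le_sum_of_subset_of_nonneg (Finset.subset_univ S) fun i _ _ => sq_nonneg _
  have hl1 : ∑ i ∈ S, (s' i - a i) ≤ ∑ i, (s' i - a i) :=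
    Finset.sum_le_sum_of_subset_of_nonneg (Finset.subset_univ S) fun i _ hi => by
      simpa [hS i hi] using hs' i
  have hkey : -(ρ * ∑ i ∈ S, (s' i - a i)) ≤ Real.sqrt (∑ i, (s' i - a i) ^ 2) := by
    refine Real.le_sqrt_of_sq_le ?_
    have h0 : 0 ≤ ∑ i ∈ S, (s' i - a i) ^ 2 := Finset.sum_nonneg fun i _ => sq_nonneg _
    calc (-(ρ * ∑ i ∈ S, (s' i - a i))) ^ 2 = ρ ^ 2 * (∑ i ∈ S, (s' i - a i)) ^ 2 := by ring
      _ ≤ ρ ^ 2 * (S.card * ∑ i ∈ S, (s' i - a i) ^ 2) := by gcongr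
      _ = (ρ ^ 2 * S.card) * ∑ i ∈ S, (s' i - a i) ^ 2 := by ring
      _ ≤ 1 * ∑ i ∈ S, (s' i - a i) ^ 2 := by gcongr
      _ ≤ _ := by linarith
  have := mul_le_mul_of_nonneg_left hl1 hρ.le
  rw [Finset.sum_sub_distrib (s := Finset.univ), mul_sub] at this
  linarith

theorem stmt_18 {n₂ : ℕ} (a : Fin n₂ → ℝ)
    (hsort : ∀ i j : Fin n₂, i ≤ j → a j ≤ a i) (hnn : ∀ i, 0 ≤ a i) (hne : a ≠ 0)
    (k : ℕ) (hk₁ : 1 ≤ k) (hk₂ : k < n₂) (ρ : ℝ) (hρ : 0 < ρ)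
    (w : Fin k → ℝ) (hw : ∀ i : Fin k, w i = a ⟨i, lt_trans i.isLt hk₂⟩)
    (c : ℝ) (hc : c = Real.sqrt (∑ i : Fin n₂, if k ≤ (i : ℕ) then a i ^ 2 else 0))
    (d : Fin k → ℝ) (hd : dSpecC ρ c w d) :
    IsOptNN a ρ (fun i => if h : (i : ℕ) < k then d ⟨i, h⟩ else 0) ↔
      wext a (norm0 w) /
          Real.sqrt ((norm0 w : ℝ) * wext a (norm0 w) ^ 2 + c ^ 2) ≤ ρ := by
  have hkn : k ≤ n₂ := hk₂.le
  have hwa : ∀ j : Fin k, w j = a (Fin.castLE hkn j) := hw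
  have hwnn : ∀ j, 0 ≤ w j := fun j => hwa j ▸ hnn _
  have hwanti : Antitone w := fun i j hij => by
    rw [hwa, hwa]; exact hsort _ _ hij
  have htail : ∀ i : Fin n₂, 0 ≤ if k ≤ (i : ℕ) then a i ^ 2 else 0 := fun i => by
    split_ifs <;> positivity
  have hc0 : 0 ≤ c := hc ▸ Real.sqrt_nonneg _
  have hc2 : c ^ 2 = ∑ i : Fin n₂, if k ≤ (i : ℕ) then a i ^ 2 else 0 := by
    rw [hc, Real.sq_sqrt (Finset.sum_nonneg fun i _ => htail i)]
  have ha0 : 0 < a ⟨0, by omega⟩ := by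
    refine lt_of_le_of_ne (hnn _) fun h => hne (funext fun i => ?_)
    exact le_antisymm ((hsort ⟨0, by omega⟩ i (Nat.zero_le _)).trans_eq h.symm) (hnn i)
  have hw0 : 0 < w ⟨0, hk₁⟩ := by rw [hw]; exact ha0
  have hsupp := ne_zero_iff_lt_norm0 hwanti hwnn
  have hℓpos : 0 < norm0 w := (hsupp ⟨0, hk₁⟩).mp hw0.ne'
  have hℓk : norm0 w ≤ k := norm0_le w
  obtain ⟨ℓ, hℓ⟩ : ∃ ℓ, ℓ = norm0 w := ⟨_, rfl⟩
  rw [← hℓ] at hsupp hℓpos hℓk ⊢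
  unfold dSpecC at hd
  rw [← hℓ] at hd
  have hℓ1 : (1 : ℝ) ≤ ℓ := by exact_mod_cast hℓpos
  have hx : wext a ℓ = a ⟨ℓ, by omega⟩ := by simp [wext, show ℓ < n₂ by omega]
  have hu : wext w (ℓ - 1) = w ⟨ℓ - 1, by omega⟩ := by simp [wext, show ℓ - 1 < k by omega]
  obtain ⟨x, hxa⟩ : ∃ x, x = a ⟨ℓ, by omega⟩ := ⟨_, rfl⟩
  obtain ⟨u, huw⟩ : ∃ u, u = w ⟨ℓ - 1, by omega⟩ := ⟨_, rfl⟩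
  rw [hx, ← hxa]
  rw [hu, ← huw] at hd
  have hx0 : 0 ≤ x := hxa ▸ hnn _
  have hxu : x ≤ u := by
    rw [hxa, huw, hwa]; exact hsort _ _ (by simp [Fin.le_def])
  have hu0 : 0 < u :=
    huw ▸ lt_of_le_of_ne (hwnn _) ((hsupp ⟨ℓ - 1, by omega⟩).mpr (by simp; omega)).symm
  have hshort : ℓ < k → x = 0 ∧ c = 0 := by
    intro hlt
    have hwℓ : w ⟨ℓ, hlt⟩ = 0 := by
      by_contra h
      exact lt_irrefl _ ((hsupp _).mp h)
    rw [hw] at hwℓ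
    refine ⟨by rw [hxa]; exact hwℓ, ?_⟩
    rw [hc, Finset.sum_eq_zero, Real.sqrt_zero]
    intro i _
    split_ifs with hi
    · have : a i ≤ a ⟨ℓ, by omega⟩ := hsort _ _ (by simp [Fin.le_def]; omega)
      have : a i = 0 := le_antisymm (hwℓ ▸ this) (hnn i)
      simp [this]
    · rfl
  have hself : ∀ y : ℝ, y ^ 2 ≤ (ℓ : ℝ) * y ^ 2 + c ^ 2 := fun y => by
    nlinarith [sq_nonneg y, sq_nonneg c]
  rw [div_sqrt_le_iff_sq_le hx0 hρ (hself x)]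
  obtain ⟨s, hs⟩ : ∃ s : Fin n₂ → ℝ, s =
      fun i : Fin n₂ => if h : (i : ℕ) < k then d ⟨i, h⟩ else 0 := ⟨_, rfl⟩
  rw [← hs]
  have hs_lt : ∀ j : Fin k, s (Fin.castLE hkn j) = d j := fun j => by simp [hs]
  have hs_ge : ∀ i : Fin n₂, k ≤ (i : ℕ) → s i = 0 := fun i hi => by simp [hs, hi]
  have hforall : ∀ P : ℝ → ℝ → Prop, (∀ j, P (d j) (w j)) →
      (∀ i : Fin n₂, k ≤ (i : ℕ) → P 0 (a i)) → ∀ i, P (s i) (a i) := by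
    intro P h1 h2 i
    rcases lt_or_ge (i : ℕ) k with hi | hi
    · have := h1 ⟨i, hi⟩
      rw [← hs_lt, hwa] at this
      exact this
    · rw [hs_ge i hi]; exact h2 i hi
  have hres : ∑ i, (s i - a i) ^ 2 = ∑ j, (d j - w j) ^ 2 + c ^ 2 := by
    rw [sum_fin_eq_sum_castLE_add_tail hkn, hc2]
    congr 1
    · exact Finset.sum_congr rfl fun j _ => by rw [hs_lt, hwa]
    · refine Finset.sum_congr rfl fun i _ => ?_
      split_ifs with hi
      · rw [hs_ge i hi]; ring
      · rfl
  rcases hd with ⟨h1, hd⟩ | ⟨h1, hd⟩ | ⟨h1, -, i, ⟨hi1, hiℓ⟩, hti, hit, hd⟩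
  · have hle : ∀ j, w j ≤ normInf w := fun j =>
      (le_abs_self _).trans (le_ciSup (f := fun i => |w i|) (Set.finite_range _).bddAbove j)
    obtain ⟨D, hD⟩ : ∃ D, D = ∑ i, w i ^ 2 + c ^ 2 := ⟨_, rfl⟩
    rw [← hD] at h1
    have hsum : w ⟨0, hk₁⟩ ^ 2 ≤ ∑ i, w i ^ 2 :=
      Finset.single_le_sum (f := fun i => w i ^ 2) (fun i _ => sq_nonneg _) (Finset.mem_univ _)
    have hDpos : 0 < D := by nlinarith [sq_nonneg c]
    have hRpos := Real.sqrt_pos.mpr hDpos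
    rw [div_le_iff₀ hRpos] at h1
    have hw0le : w ⟨0, hk₁⟩ ≤ ρ * Real.sqrt D := (hle _).trans h1
    refine iff_of_true ?_ ?_
    · refine isOptNN_of_kkt (R := Real.sqrt D) ?_ hRpos ?_ ?_ ?_
      · exact hforall (fun y _ => 0 ≤ y) (by simp [hd]) (by simp)
      · rw [hres, Real.sq_sqrt hDpos.le, hD]; simp [hd]
      · refine hforall (fun y z => z - y ≤ ρ * Real.sqrt D) ?_ ?_
        · intro j; simpa [hd] using (hle j).trans h1
        · intro i _
          have := hsort ⟨0, by omega⟩ i (Nat.zero_le _)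
          rw [hw] at hw0le
          simpa using this.trans hw0le
      · exact hforall (fun y z => y * (ρ * Real.sqrt D - (z - y)) = 0) (by simp [hd]) (by simp)
    · rcases hℓk.lt_or_eq with hlt | heq
      · rw [(hshort hlt).1, (hshort hlt).2]; simp
      · refine sq_le_mul_of_le (u := w ⟨0, hk₁⟩) hx0 ?_ (sq_nonneg c) ?_
        · rw [hxa, hw]; exact hsort _ _ (Nat.zero_le _)
        · have hpow := pow_le_pow_left₀ hw0.le hw0le 2
          rw [mul_pow, Real.sq_sqrt hDpos.le, hD] at hpow
          refine hpow.trans (mul_le_mul_of_nonneg_left ?_ (sq_nonneg ρ))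
          have : ∑ i, w i ^ 2 ≤ ∑ _i : Fin k, w ⟨0, hk₁⟩ ^ 2 :=
            Finset.sum_le_sum fun i _ =>
              pow_le_pow_left₀ (hwnn i) (hwanti (show (⟨0, hk₁⟩ : Fin k) ≤ i from Nat.zero_le _)) 2
          rw [Finset.sum_const, Finset.card_univ, Fintype.card_fin, nsmul_eq_mul] at this
          rw [heq]
          linarith
  · have h1' := mul_le_sq_of_le_div_sqrt hρ ((sq_nonneg u).trans (hself u)) h1
    rcases hc0.eq_or_lt with hcz | hcpos
    · have hdw : d = w := by rw [hd, ← hcz]; simp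
      have htailz : ∀ i : Fin n₂, k ≤ (i : ℕ) → a i = 0 := by
        intro i hi
        rw [← hcz] at hc2
        have := (Finset.sum_eq_zero_iff_of_nonneg
          (fun i _ => htail i)).mp (hc2.symm.trans (zero_pow two_ne_zero)) i
          (Finset.mem_univ i)
        simpa [hi] using this
      have hsa : s = a := funext (hforall (fun y z => y = z) (by simp [hdw])
        (fun i hi => (htailz i hi).symm))
      have hxz : x = 0 := by
        rcases hℓk.lt_or_eq with hlt | heq
        · exact (hshort hlt).1
        · exact hxa ▸ htailz _ heq.ge
      refine iff_of_true ?_ (by rw [hxz, ← hcz]; simp)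
      rw [hsa]
      refine isOptNN_self hnn hρ (Finset.Iio ⟨ℓ, by omega⟩) ?_ ?_
      · intro i hi
        have hi : (⟨ℓ, by omega⟩ : Fin n₂) ≤ i := by simpa using hi
        exact le_antisymm (hxz ▸ hxa ▸ hsort _ _ hi) (hnn i)
      · rw [Fin.card_Iio]
        rw [← hcz] at h1'
        refine le_of_mul_le_mul_right ?_ (pow_pos hu0 2)
        simp only
        linarith
    · have heq : ℓ = k := by
        rcases hℓk.lt_or_eq with hlt | heq
        · exact absurd (hshort hlt).2 hcpos.ne'
        · exact heq
      rw [heq] at h1' ⊢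
      have hq : 0 < 1 - (k : ℝ) * ρ ^ 2 := by
        have : 0 < u ^ 2 * (1 - (k : ℝ) * ρ ^ 2) := by
          have : 0 < ρ ^ 2 * c ^ 2 := by positivity
          linarith
        exact pos_of_mul_pos_right this (by positivity)
      obtain ⟨R, hR⟩ : ∃ R, R = Real.sqrt (c ^ 2 / (1 - (k : ℝ) * ρ ^ 2)) := ⟨_, rfl⟩
      rw [← hR] at hd
      have hRpos : 0 < R := hR ▸ Real.sqrt_pos.mpr (by positivity)
      have hR2 : R ^ 2 * (1 - (k : ℝ) * ρ ^ 2) = c ^ 2 := by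
        rw [hR, Real.sq_sqrt (by positivity)]; field_simp
      have hresR : ∑ i, (s i - a i) ^ 2 = R ^ 2 := by
        rw [hres, ← hR2, hd]
        simp
        ring
      have hRu : ρ * R ≤ u := by
        refine (abs_le_of_sq_le_sq' ?_ hu0.le).2
        refine le_of_mul_le_mul_right ?_ hq
        nlinarith
      have huj : ∀ j, u ≤ w j := fun j =>
        huw ▸ hwanti (show j ≤ ⟨ℓ - 1, by omega⟩ by simp [Fin.le_def]; omega)
      have hcond : x ≤ ρ * R ↔ x ^ 2 ≤ ρ ^ 2 * ((k : ℝ) * x ^ 2 + c ^ 2) := by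
        rw [← abs_of_nonneg hx0, ← abs_of_nonneg (mul_nonneg hρ.le hRpos.le), ← sq_le_sq,
          ← mul_le_mul_iff_left₀ hq, sq_abs, mul_pow, mul_assoc, hR2]
        constructor <;> intro h <;> linarith
      rw [← hcond]
      constructor
      · intro hopt
        have := hopt.le_mul_residual hρ hRpos.le hresR (hs_ge ⟨ℓ, by omega⟩ heq.ge)
        rwa [← hxa] at this
      · intro hle
        refine isOptNN_of_kkt ?_ hRpos hresR ?_ ?_
        · exact hforall (fun y _ => 0 ≤ y)
            (fun j => by rw [hd]; linarith [huj j]) (by simp)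
        · refine hforall (fun y z => z - y ≤ ρ * R) (by simp [hd]) fun i hi => ?_
          have : a i ≤ x := hxa ▸ hsort _ _ (by simp [Fin.le_def]; omega)
          linarith
        · exact hforall (fun y z => y * (ρ * R - (z - y)) = 0) (by simp [hd]) (by simp)
  · obtain ⟨t, ht⟩ : ∃ t, t = tQ ρ c w i := ⟨_, rfl⟩
    rw [← ht] at hti hit hd
    have hwi : wext w i = w ⟨i, by omega⟩ := by simp [wext, show i < k by omega]
    have hwi' : wext w (i - 1) = w ⟨i - 1, by omega⟩ := by simp [wext, show i - 1 < k by omega]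
    rw [hwi] at hti
    rw [hwi'] at hit
    have hwipos : 0 < w ⟨i, by omega⟩ :=
      lt_of_le_of_ne (hwnn _) ((hsupp ⟨i, by omega⟩).mpr (by simp; omega)).symm
    have htpos : 0 < t := by linarith
    have hlow : ∀ j : Fin k, (j : ℕ) < i → t < w j := fun j hj =>
      hit.trans_le (hwanti (show j ≤ ⟨i - 1, by omega⟩ by simp [Fin.le_def]; omega))
    have hhigh : ∀ j : Fin k, i ≤ (j : ℕ) → w j ≤ t := fun j hj =>
      (hwanti (show (⟨i, by omega⟩ : Fin k) ≤ j from hj)).trans hti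
    have hquot : 0 < (tailSq w i + c ^ 2) / (1 / ρ ^ 2 - i) := by
      rw [ht, tQ] at htpos; exact Real.sqrt_pos.mp htpos
    have hden : 1 / ρ ^ 2 - (i : ℝ) ≠ 0 := fun h => by
      rw [h, div_zero] at hquot; exact lt_irrefl _ hquot
    have ht2 : (i : ℝ) * t ^ 2 + tailSq w i + c ^ 2 = (t / ρ) ^ 2 := by
      have : t ^ 2 * (1 / ρ ^ 2 - i) = tailSq w i + c ^ 2 := by
        rw [ht, tQ, Real.sq_sqrt hquot.le, div_mul_cancel₀ _ hden]
      rw [div_pow, div_eq_mul_one_div]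
      linarith
    have hρt : ρ * (t / ρ) = t := mul_div_cancel₀ t hρ.ne'
    refine iff_of_true ?_ ?_
    · refine isOptNN_of_kkt (R := t / ρ) ?_ (by positivity) ?_ ?_ ?_
      · exact hforall (fun y _ => 0 ≤ y) (by simp [hd]) (by simp)
      · rw [hres, ← ht2]
        congr 1
        have hik : i ≤ k := by omega
        have hsq : ∀ j, (d j - w j) ^ 2 = if (j : ℕ) < i then t ^ 2 else w j ^ 2 := by
          intro j
          simp only [hd]
          split_ifs with hj
          · rw [max_eq_left (by linarith [hlow j hj])]; ring
          · rw [max_eq_right (by linarith [hhigh j (not_lt.mp hj)])]; ring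
        rw [sum_fin_eq_sum_castLE_add_tail hik, tailSq]
        congr 1
        · simp [hsq]
        · refine Finset.sum_congr rfl fun j _ => ?_
          split_ifs with hj
          · rw [hsq, if_neg (not_lt.mpr hj)]
          · rfl
      · rw [hρt]
        refine hforall (fun y z => z - y ≤ t) ?_ ?_
        · intro j
          have := le_max_left (w j - t) 0
          rw [hd]
          linarith
        · intro j hj
          have : a j ≤ w ⟨i, by omega⟩ := by
            rw [hw]; exact hsort _ _ (by simp [Fin.le_def]; omega)
          linarith
      · rw [hρt]
        refine hforall (fun y z => y * (t - (z - y)) = 0) ?_ (by simp)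
        intro j
        rw [hd]
        rcases le_total (w j - t) 0 with h | h
        · simp [h]
        · simp [max_eq_left h]
    · refine sq_le_mul_of_le hx0 hxu (sq_nonneg c) ?_
      exact (div_sqrt_le_iff_sq_le hu0.le hρ (hself u)).mp h1.le
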